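/- Let n ≥ 2 and let G = ⟨α, τ | α^{2n} = 1_G, τ^2 = α^n, τα = α^{-1}τ⟩ be a dicyclic group of order 4n. Then there is no minimal product-one sequence S over G such that S = S_1 · S_2 where S_1 is a sequence with all terms in ⟨α⟩ and S_2 is a sequence with all terms in G \ ⟨α⟩ of length |S_2| ≥ 2n + 4. -/

import Mathlib

/-- A multiset over a group is a *product-one sequence* if its terms can be
ordered so that their product is `1`. -/
def IsProductOne {G : Type*} [Group G] (S : Multiset G) : Prop :=
  ∃ l : List G, (l : Multiset G) = S ∧ l.prod = 1

/-- A product-one sequence is *minimal* if it is non-trivial and cannot be written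
as a concatenation of two non-trivial product-one sequences. -/
def IsMinimalProductOne {G : Type*} [Group G] (S : Multiset G) : Prop :=
  S ≠ 0 ∧ IsProductOne S ∧
    ∀ T₁ T₂ : Multiset G, T₁ ≠ 0 → T₂ ≠ 0 → IsProductOne T₁ → IsProductOne T₂ →
      S ≠ T₁ + T₂

open Multiset

/-- Davenport constant bound for a subgroup. -/
theorem dav {ι Q : Type*} [AddCommGroup Q] [Finite Q] (K : AddSubgroup Q) (f : ι → Q)
    (X : Multiset ι) (hX : ∀ x ∈ X, f x ∈ K) (hc : Nat.card K ≤ card X) :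
    ∃ Z ≤ X, Z ≠ 0 ∧ (Z.map f).sum = 0 := by
  induction X using Quotient.inductionOn with
  | h l =>
  simp only [quot_mk_to_coe, mem_coe, coe_card] at hX hc
  have hmem : ∀ j : ℕ, ((l.take j).map f).sum ∈ K := by
    intro j
    apply AddSubgroup.list_sum_mem
    intro x hx
    obtain ⟨y, hy, rfl⟩ := List.mem_map.1 hx
    exact hX y (List.mem_of_mem_take hy)
  let g : Fin (l.length + 1) → K := fun j => ⟨((l.take j).map f).sum, hmem j⟩
  have hni : ¬ Function.Injective g := by
    intro hi
    have := Nat.card_le_card_of_injective g hi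
    simp at this
    omega
  have key : ∀ i j : Fin (l.length + 1), i < j → g i = g j →
      ∃ Z ≤ (l : Multiset ι), Z ≠ 0 ∧ (Z.map f).sum = 0 := by
    intro i j hij h
    have h' : ((l.take i).map f).sum = ((l.take j).map f).sum := congrArg Subtype.val h
    have hlt : (i : ℕ) < j := hij
    have hj : (j : ℕ) ≤ l.length := by omega
    have hsplit : l.take j = l.take i ++ (l.take j).drop i := by
      conv_lhs => rw [← List.take_append_drop i (l.take j)]
      rw [List.take_take, min_eq_left hlt.le]
    refine ⟨((l.take j).drop i : List ι), ?_, ?_, ?_⟩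
    · exact coe_le.2 (((List.drop_sublist _ _).trans (List.take_sublist _ _)).subperm)
    · rw [Ne, coe_eq_zero]
      intro h0
      have := congrArg List.length h0
      simp at this
      omega
    · rw [hsplit] at h'
      simp only [List.map_append, List.sum_append] at h'
      simpa using h'
  simp only [Function.Injective, not_forall] at hni
  obtain ⟨i, j, h, hne⟩ := hni
  rcases lt_or_gt_of_ne hne with hlt | hlt
  · exact key i j hlt h
  · exact key j i hlt h.symm

/-- The set of subsums. -/
def SubS {Q : Type*} [AddCommGroup Q] (W : Multiset Q) : Set Q := {g | ∃ T ≤ W, T.sum = g}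

theorem mem_subS_cons {Q : Type*} [AddCommGroup Q] (W : Multiset Q) (v g : Q) :
    g ∈ SubS (v ::ₘ W) ↔ g ∈ SubS W ∨ g - v ∈ SubS W := by
  classical
  constructor
  · rintro ⟨T, hT, rfl⟩
    by_cases hv : v ∈ T
    · obtain ⟨T', rfl⟩ := exists_cons_of_mem hv
      right
      exact ⟨T', (cons_le_cons_iff v).1 hT, by simp⟩
    · left
      exact ⟨T, (le_cons_of_notMem hv).1 hT, rfl⟩
  · rintro (⟨T, hT, rfl⟩ | ⟨T, hT, h⟩)
    · exact ⟨T, hT.trans (le_cons_self _ _), rfl⟩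
    · exact ⟨v ::ₘ T, (cons_le_cons_iff v).2 hT, by simp [h]⟩

open Classical in
theorem subS_growth {Q : Type*} [AddCommGroup Q] [Finite Q] (W : Multiset Q) :
    (∃ g : Q, g ≠ 0 ∧ ∀ x ∈ SubS W, g + x ∈ SubS W) ∨
      1 + card (W.filter (fun v => v ≠ 0)) ≤ (SubS W).ncard := by
  classical
  induction W using Multiset.induction with
  | empty =>
    right
    have : SubS (0 : Multiset Q) = {0} := by
      ext g; simp [SubS, eq_comm]
    simp [this]
  | cons v W ih =>
    rcases ih with ⟨g, hg, h⟩ | h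
    · left
      refine ⟨g, hg, fun x hx => ?_⟩
      rw [mem_subS_cons] at hx ⊢
      rcases hx with hx | hx
      · exact Or.inl (h _ hx)
      · right
        have := h _ hx
        rwa [add_sub_assoc]
    · by_cases hv : v = 0
      · right
        have : SubS (v ::ₘ W) = SubS W := by
          ext g; rw [mem_subS_cons]; simp [hv]
        rw [this]
        simpa [hv] using h
      · by_cases hp : ∀ x ∈ SubS W, v + x ∈ SubS W
        · left
          refine ⟨v, hv, fun x hx => ?_⟩
          rw [mem_subS_cons] at hx ⊢
          rcases hx with hx | hx
          · exact Or.inl (hp _ hx)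
          · right
            have := hp _ hx
            rwa [add_sub_assoc]
        · right
          push Not at hp
          obtain ⟨x, hx, hx'⟩ := hp
          have : SubS W ⊂ SubS (v ::ₘ W) := by
            refine Set.ssubset_iff_exists.2 ⟨fun y hy => (mem_subS_cons _ _ _).2 (Or.inl hy),
              v + x, (mem_subS_cons _ _ _).2 (Or.inr (by simpa using hx)), hx'⟩
          have := Set.ncard_lt_ncard this (Set.toFinite _)
          rw [filter_cons_of_pos (p := fun v : Q => v ≠ 0) _ hv]
          simp only [card_cons]
          omega

theorem subS_map {Q R : Type*} [AddCommGroup Q] [AddCommGroup R] (φ : Q →+ R)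
    (W : Multiset Q) : SubS (W.map φ) = φ '' SubS W := by
  induction W using Multiset.induction with
  | empty => ext g; simp [SubS, eq_comm]
  | cons v W ih =>
    ext g
    rw [map_cons, mem_subS_cons, ih]
    constructor
    · rintro (⟨x, hx, rfl⟩ | ⟨x, hx, h⟩)
      · exact ⟨x, (mem_subS_cons _ _ _).2 (Or.inl hx), rfl⟩
      · refine ⟨x + v, (mem_subS_cons _ _ _).2 (Or.inr (by simpa using hx)), by simp [h]⟩
    · rintro ⟨x, hx, rfl⟩
      rcases (mem_subS_cons _ _ _).1 hx with hx | hx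
      · exact Or.inl ⟨x, hx, rfl⟩
      · exact Or.inr ⟨_, hx, by simp⟩

open Classical in
theorem subS_kneser {Q : Type*} [AddCommGroup Q] [Finite Q] (W : Multiset Q) :
    ∃ K : AddSubgroup Q, (∀ g ∈ K, ∀ x ∈ SubS W, g + x ∈ SubS W) ∧
      1 + card (W.filter (fun v => v ∉ K)) ≤ K.index := by
  have hfin : ∀ g : Q, (∀ x ∈ SubS W, g + x ∈ SubS W) → (∀ x ∈ SubS W, -g + x ∈ SubS W) := by
    intro g hg x hx
    have hs : (fun y => g + y) '' SubS W ⊆ SubS W := by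
      rintro _ ⟨y, hy, rfl⟩; exact hg y hy
    have he : (fun y => g + y) '' SubS W = SubS W := by
      apply Set.eq_of_subset_of_ncard_le hs _ (Set.toFinite _)
      rw [Set.ncard_image_of_injective _ (add_right_injective g)]
    rw [← he] at hx
    obtain ⟨y, hy, rfl⟩ := hx
    simpa using hy
  let K : AddSubgroup Q :=
    { carrier := {g | ∀ x ∈ SubS W, g + x ∈ SubS W}
      zero_mem' := by intro x hx; simpa using hx
      add_mem' := by
        intro a b ha hb x hx
        rw [add_assoc]
        exact ha _ (hb _ hx)
      neg_mem' := by intro a ha; exact hfin a ha }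
  have hK : ∀ g, g ∈ K ↔ ∀ x ∈ SubS W, g + x ∈ SubS W := fun g => Iff.rfl
  refine ⟨K, fun g hg => hg, ?_⟩
  have hmap := subS_map (QuotientAddGroup.mk' K) W
  rcases subS_growth (W.map (QuotientAddGroup.mk' K)) with ⟨g, hg, h⟩ | h
  · exfalso
    obtain ⟨g, rfl⟩ := QuotientAddGroup.mk'_surjective K g
    apply hg
    rw [QuotientAddGroup.mk'_apply, QuotientAddGroup.eq_zero_iff, hK]
    intro x hx
    have := h _ (hmap ▸ Set.mem_image_of_mem _ hx)
    rw [hmap] at this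
    obtain ⟨y, hy, hxy⟩ := this
    rw [← _root_.map_add, QuotientAddGroup.mk'_apply, QuotientAddGroup.mk'_apply,
      QuotientAddGroup.eq] at hxy
    have := (hK _).1 hxy y hy
    have e : -y + (g + x) + y = g + x := by abel
    rwa [e] at this
  · have h1 : (SubS (W.map (QuotientAddGroup.mk' K))).ncard ≤ K.index := by
      rw [AddSubgroup.index]
      exact Set.ncard_le_card _
    rw [filter_map, card_map] at h
    refine le_trans ?_ (h.trans h1)
    apply Nat.add_le_add_left
    apply le_of_eq
    congr 1
    have hpe : ((fun v => v ≠ 0) ∘ (QuotientAddGroup.mk' K)) = fun v => v ∉ K := by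
      funext x
      simp [QuotientAddGroup.eq_zero_iff]
    simp only [hpe]

theorem exists_le_card' {ι : Type*} (X : Multiset ι) (k : ℕ) (h : k ≤ card X) :
    ∃ V ≤ X, card V = k := by
  induction X using Quotient.inductionOn with
  | h l =>
  refine ⟨(l.take k : List ι), coe_le.2 (List.take_sublist _ _).subperm, ?_⟩
  simpa using h

/-- Two disjoint zero-sum pieces. -/
theorem two_zero {ι Q : Type*} [AddCommGroup Q] [Finite Q] (d : ι → Q) (K : AddSubgroup Q)
    (hK : K ≠ ⊤) (F V : Multiset ι) (hVF : V ≤ F) (hV : ∀ v ∈ V, d v ∈ K)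
    (hF : Nat.card Q + 2 ≤ card F) (hcV : Nat.card Q + 1 ≤ card V + K.index) :
    ∃ T T' : Multiset ι, T ≠ 0 ∧ T' ≠ 0 ∧ T + T' ≤ F ∧ card (T + T') < card F ∧
      (T.map d).sum = 0 ∧ (T'.map d).sum = 0 := by
  have hkq : Nat.card K * K.index = Nat.card Q := K.card_mul_index
  have hk : 1 ≤ Nat.card K := Nat.card_pos
  have hq : 2 ≤ K.index := by
    have h0 : K.index ≠ 0 := AddSubgroup.index_ne_zero_of_finite
    have h1 : K.index ≠ 1 := fun h => hK (AddSubgroup.index_eq_one.1 h)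
    omega
  set k := Nat.card K with hkdef
  set q := K.index with hqdef
  have hineq : 2 * k + q ≤ Nat.card Q + 2 := by
    rw [← hkq]
    obtain ⟨k', hk'⟩ := Nat.exists_eq_add_of_le hk
    obtain ⟨q', hq'⟩ := Nat.exists_eq_add_of_le hq
    rw [hk', hq']
    nlinarith [Nat.zero_le (k' * q')]
  obtain ⟨V0, hV0, hV0c⟩ := exists_le_card' V (k + (k - 1)) (by omega)
  obtain ⟨V1, hV1, hV1c⟩ := exists_le_card' V0 k (by omega)
  obtain ⟨V2, rfl⟩ := Multiset.le_iff_exists_add.1 hV1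
  have hV2c : card V2 = k - 1 := by rw [card_add] at hV0c; omega
  obtain ⟨R, rfl⟩ := Multiset.le_iff_exists_add.1 (hV0.trans hVF)
  have hRc : q ≤ card R := by
    rw [card_add] at hF; omega
  obtain ⟨V3, hV3, hV3c⟩ := exists_le_card' R q hRc
  have hmemV : ∀ v ∈ V1 + V2, d v ∈ K := fun v hv => hV v (mem_of_le hV0 hv)
  obtain ⟨Z1, hZ1, hZ1n, hZ1s⟩ := dav K d V1 (fun x hx => hmemV x (by simp [hx])) (by omega)
  obtain ⟨Y, hY, hYn, hYs⟩ := dav (⊤ : AddSubgroup (Q ⧸ K)) (fun x => (QuotientAddGroup.mk' K) (d x))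
    V3 (by simp) (by
      rw [Nat.card_congr AddSubgroup.topEquiv.toEquiv, hV3c]; exact le_rfl)
  have hYK : (Y.map d).sum ∈ K := by
    rw [← QuotientAddGroup.eq_zero_iff, ← QuotientAddGroup.mk'_apply, map_multiset_sum, map_map]
    exact hYs
  obtain ⟨Z, hZ, hZn, hZs⟩ := dav K (fun T : Multiset ι => (T.map d).sum)
    (Y ::ₘ V2.map (fun x => {x})) (by
      intro T hT
      rcases mem_cons.1 hT with rfl | hT
      · exact hYK
      · obtain ⟨x, hx, rfl⟩ := mem_map.1 hT
        simpa using hmemV x (by simp [hx])) (by simp; omega)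
  have hjoin : Z.join ≤ Y + V2 := by
    obtain ⟨U, hU⟩ := Multiset.le_iff_exists_add.1 hZ
    have := congrArg Multiset.join hU
    rw [join_add, join_cons] at this
    have h2 : (V2.map (fun x => ({x} : Multiset ι))).join = V2 := by
      simp [Multiset.join]
    rw [h2] at this
    rw [this]
    exact le_add_right _ _
  refine ⟨Z1, Z.join, hZ1n, ?_, ?_, ?_, hZ1s, ?_⟩
  · obtain ⟨T, hT⟩ := exists_mem_of_ne_zero hZn
    have hTn : T ≠ 0 := by
      rcases mem_cons.1 (mem_of_le hZ hT) with rfl | h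
      · exact hYn
      · obtain ⟨x, hx, rfl⟩ := mem_map.1 h
        simp
    obtain ⟨x, hx⟩ := exists_mem_of_ne_zero hTn
    intro h0
    have : x ∈ Z.join := mem_join.2 ⟨T, hT, hx⟩
    rw [h0] at this
    simp at this
  · calc Z1 + Z.join ≤ V1 + (Y + V2) := add_le_add hZ1 hjoin
      _ ≤ V1 + (R + V2) := by gcongr; exact hY.trans hV3
      _ = V1 + V2 + R := by abel
  · have h1 := card_le_card hZ1
    have h2 := card_le_card hjoin
    have h3 := card_le_card hY
    simp only [card_add] at *
    omega
  · rw [map_join, sum_join, map_map]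
    exact hZs

section Quat

variable {n : ℕ}

/-- The contribution of a pair of reflections. -/
def dl (n : ℕ) (w : ZMod (2 * n) × ZMod (2 * n)) : ZMod (2 * n) := w.1 - w.2 + n

/-- The terms belonging to a multiset of pairs. -/
def prs (W : Multiset (ZMod (2 * n) × ZMod (2 * n))) : Multiset (QuaternionGroup n) :=
  W.map (fun w => QuaternionGroup.xa w.1) + W.map (fun w => QuaternionGroup.xa w.2)

/-- `S` can be ordered to have product `g`. -/
def IsPr {G : Type*} [Group G] (S : Multiset G) (g : G) : Prop :=
  ∃ l : List G, (l : Multiset G) = S ∧ l.prod = g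

theorem IsPr.add {G : Type*} [Group G] {S T : Multiset G} {g h : G} (hS : IsPr S g)
    (hT : IsPr T h) : IsPr (S + T) (g * h) := by
  obtain ⟨l, rfl, rfl⟩ := hS
  obtain ⟨l', rfl, rfl⟩ := hT
  exact ⟨l ++ l', by simp, by simp⟩

theorem isPr_single {G : Type*} [Group G] (g : G) : IsPr {g} g := ⟨[g], by simp, by simp⟩

theorem isPr_a (A : Multiset (ZMod (2 * n))) :
    IsPr (A.map QuaternionGroup.a) (QuaternionGroup.a A.sum) := by
  induction A using Multiset.induction with
  | empty => exact ⟨[], by simp, by simp⟩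
  | cons v A ih =>
    have := (isPr_single (QuaternionGroup.a v)).add ih
    simpa using this

theorem two_n : (n : ZMod (2 * n)) + n = 0 := by
  have : ((2 * n : ℕ) : ZMod (2 * n)) = 0 := ZMod.natCast_self _
  push_cast at this
  rw [← this]; ring

theorem isPr_prs (W : Multiset (ZMod (2 * n) × ZMod (2 * n))) :
    IsPr (prs W) (QuaternionGroup.a (W.map (dl n)).sum) := by
  induction W using Multiset.induction with
  | empty => exact ⟨[], by simp [prs], by simp⟩
  | cons w W ih =>
    have := ((isPr_single (QuaternionGroup.xa w.2)).add
      (isPr_single (QuaternionGroup.xa w.1))).add ih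
    have e1 : prs (w ::ₘ W) = {QuaternionGroup.xa w.2} + {QuaternionGroup.xa w.1} + prs W := by
      simp only [prs, map_cons]; simp only [← singleton_add]; abel
    have e2 : (QuaternionGroup.a ((w ::ₘ W).map (dl n)).sum : QuaternionGroup n) =
      QuaternionGroup.xa w.2 * QuaternionGroup.xa w.1 * QuaternionGroup.a (W.map (dl n)).sum := by
      simp only [map_cons, sum_cons, QuaternionGroup.xa_mul_xa, QuaternionGroup.a_mul_a, dl]
      congr 1; ring
    rw [e1, e2]; exact this

theorem prod_one_of (A B : Multiset (ZMod (2 * n)))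
    (W : Multiset (ZMod (2 * n) × ZMod (2 * n))) (hW : W ≠ 0)
    (h : (W.map (dl n)).sum + A.sum - B.sum = 0) :
    IsProductOne (A.map QuaternionGroup.a + B.map QuaternionGroup.a + prs W) := by
  obtain ⟨w, hw⟩ := exists_mem_of_ne_zero hW
  obtain ⟨W, rfl⟩ := exists_cons_of_mem hw
  have := ((((isPr_a A).add (isPr_single (QuaternionGroup.xa w.2))).add (isPr_a B)).add
    (isPr_single (QuaternionGroup.xa w.1))).add (isPr_prs W)
  have e1 : A.map QuaternionGroup.a + B.map QuaternionGroup.a + prs (w ::ₘ W) =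
     A.map QuaternionGroup.a + {QuaternionGroup.xa w.2} + B.map QuaternionGroup.a +
      {QuaternionGroup.xa w.1} + prs W := by
    simp only [prs, map_cons]; simp only [← singleton_add]; abel
  rw [e1]
  obtain ⟨l, hl, hp⟩ := this
  refine ⟨l, hl, ?_⟩
  rw [hp]
  simp only [QuaternionGroup.xa_mul_xa, QuaternionGroup.a_mul_a, QuaternionGroup.a_mul_xa,
    QuaternionGroup.xa_mul_a, QuaternionGroup.one_def]
  congr 1
  rw [← h]
  simp only [map_cons, sum_cons, dl]
  ring

theorem list_decomp (l : List (QuaternionGroup n)) :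
    ∃ A B P N : Multiset (ZMod (2 * n)),
      (l : Multiset (QuaternionGroup n)) = A.map QuaternionGroup.a + B.map QuaternionGroup.a +
        (P.map QuaternionGroup.xa + N.map QuaternionGroup.xa) ∧
      ((card P = card N ∧
        l.prod = QuaternionGroup.a (P.sum - N.sum + (card N : ZMod (2 * n)) * (n : ZMod (2 * n)) + A.sum - B.sum)) ∨
       (card P = card N + 1 ∧
        l.prod = QuaternionGroup.xa (P.sum - N.sum + (card N : ZMod (2 * n)) * (n : ZMod (2 * n)) + A.sum - B.sum))) := by
  induction l with
  | nil => exact ⟨0, 0, 0, 0, by simp, Or.inl ⟨rfl, by simp⟩⟩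
  | cons g l ih =>
    obtain ⟨A, B, P, N, hl, h⟩ := ih
    rw [← cons_coe, hl]
    rcases h with ⟨hc, hp⟩ | ⟨hc, hp⟩
    · rcases g with i | i
      · refine ⟨i ::ₘ A, B, P, N, by simp, Or.inl ⟨hc, ?_⟩⟩
        rw [List.prod_cons, hp, QuaternionGroup.a_mul_a]
        congr 1; simp only [sum_cons]; ring
      · refine ⟨A, B, i ::ₘ P, N, by simp, Or.inr ⟨by simpa using hc, ?_⟩⟩
        rw [List.prod_cons, hp, QuaternionGroup.xa_mul_a]
        congr 1; simp only [sum_cons]; ring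
    · rcases g with i | i
      · refine ⟨A, i ::ₘ B, P, N, by simp, Or.inr ⟨hc, ?_⟩⟩
        rw [List.prod_cons, hp, QuaternionGroup.a_mul_xa]
        congr 1; simp only [sum_cons]; ring
      · refine ⟨A, B, P, i ::ₘ N, by simp, Or.inl ⟨by simpa using hc, ?_⟩⟩
        rw [List.prod_cons, hp, QuaternionGroup.xa_mul_xa]
        congr 1; simp only [sum_cons, card_cons]; push_cast; ring

theorem exists_pairs {X Y : Type*} (P : Multiset X) : ∀ (N : Multiset Y), card P = card N →
    ∃ W : Multiset (X × Y), W.map Prod.fst = P ∧ W.map Prod.snd = N := by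
  induction P using Multiset.induction with
  | empty =>
    intro N h
    have : N = 0 := card_eq_zero.1 (by simpa using h.symm)
    exact ⟨0, by simp [this]⟩
  | cons p P ih =>
    intro N h
    have hN : N ≠ 0 := by rintro rfl; simp at h
    obtain ⟨q, hq⟩ := exists_mem_of_ne_zero hN
    obtain ⟨N, rfl⟩ := exists_cons_of_mem hq
    obtain ⟨W, h1, h2⟩ := ih N (by simpa using h)
    exact ⟨(p, q) ::ₘ W, by simp [h1], by simp [h2]⟩

theorem exists_dup {X Y : Type*} [Finite Y] (f : X → Y) (P : Multiset X)
    (h : Nat.card Y < card P) : ∃ x x' P', P = x ::ₘ x' ::ₘ P' ∧ f x = f x' := by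
  classical
  have : Fintype Y := Fintype.ofFinite Y
  have hnd : ¬ (P.map f).Nodup := by
    intro hnd
    have := Finset.card_le_univ (⟨P.map f, hnd⟩ : Finset Y)
    simp only [Finset.card_mk, card_map] at this
    rw [Nat.card_eq_fintype_card] at h
    omega
  rw [nodup_iff_le] at hnd
  push Not at hnd
  obtain ⟨y, hy⟩ := hnd
  obtain ⟨U, hU⟩ := Multiset.le_iff_exists_add.1 hy
  rw [cons_add, ← map_eq_cons] at hU
  obtain ⟨x, hx, hfx, h2⟩ := hU
  rw [cons_add, ← map_eq_cons] at h2
  obtain ⟨x', hx', hfx', h3⟩ := h2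
  refine ⟨x, x', (P.erase x).erase x', ?_, by rw [hfx, hfx']⟩
  rw [cons_erase hx', cons_erase hx]

/-- Reduction modulo `n`. -/
def red (n : ℕ) : ZMod (2 * n) →+* ZMod n := ZMod.castHom (Dvd.intro_left 2 rfl) (ZMod n)

theorem red_zero (hn : 0 < n) (c : ZMod (2 * n)) (h : red n c = 0) : c = 0 ∨ c = n := by
  have : NeZero (2 * n) := ⟨by omega⟩
  have e : ((c.val : ℕ) : ZMod (2 * n)) = c := ZMod.natCast_zmod_val c
  rw [← e, map_natCast, ZMod.natCast_eq_zero_iff] at h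
  obtain ⟨j, hj⟩ := h
  have hlt := ZMod.val_lt c
  rw [hj] at hlt
  have hj2 : j < 2 := by
    by_contra hcon
    push Not at hcon
    nlinarith
  rw [← e, hj]
  interval_cases j <;> simp

theorem red_eq (hn : 0 < n) (c e : ZMod (2 * n)) (h : red n c = red n e) : c = e ∨ c = e + n := by
  rcases red_zero hn (c - e) (by rw [map_sub, h, sub_self]) with h | h
  · left; exact sub_eq_zero.1 h
  · right; rw [← h]; ring

theorem two_mul_eq (hn : 0 < n) (c e : ZMod (2 * n)) (h : red n c = red n e) :
    c + c = e + e := by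
  rcases red_eq hn c e h with rfl | rfl
  · rfl
  · linear_combination (two_n : (n : ZMod (2 * n)) + n = 0)

theorem red_n : red n (n : ZMod (2 * n)) = 0 := by simp

theorem prs_add (W W' : Multiset (ZMod (2 * n) × ZMod (2 * n))) :
    prs (W + W') = prs W + prs W' := by
  simp only [prs, Multiset.map_add]; abel

theorem le_map_lift {X Y : Type*} (f : X → Y) (T : Multiset Y) : ∀ W : Multiset X,
    T ≤ W.map f → ∃ U ≤ W, U.map f = T := by
  classical
  induction T using Multiset.induction with
  | empty => exact fun W _ => ⟨0, Multiset.zero_le _, by simp⟩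
  | cons b T ih =>
    intro W h
    obtain ⟨u, hu⟩ := Multiset.le_iff_exists_add.1 h
    rw [cons_add, ← map_eq_cons] at hu
    obtain ⟨a, ha, hfa, h2⟩ := hu
    obtain ⟨U, hU, hUT⟩ := ih (W.erase a) (by rw [h2]; exact le_add_right _ _)
    refine ⟨a ::ₘ U, ?_, by simp [hUT, hfa]⟩
    rw [← cons_erase ha]
    exact (cons_le_cons_iff a).2 hU

/-- Flipping pairs. -/
theorem flip_pairs (hn : 0 < n) (W : Multiset (ZMod (2 * n) × ZMod (2 * n)))
    (hu : ∀ g, g ∈ SubS (W.map (fun w => red n (dl n w)))) (t : ZMod (2 * n)) :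
    ∃ W', prs W' = prs W ∧ card W' = card W ∧
      (W'.map (dl n)).sum = (W.map (dl n)).sum - (t + t) := by
  classical
  obtain ⟨X, hX, hXs⟩ := hu (red n t)
  obtain ⟨T, hT, rfl⟩ : ∃ T ≤ W, T.map (fun w => red n (dl n w)) = X := by
    obtain ⟨T, hT, h⟩ := le_map_lift _ X W hX
    exact ⟨T, hT, h⟩
  obtain ⟨U, rfl⟩ := Multiset.le_iff_exists_add.1 hT
  have h1 : red n (T.map (dl n)).sum = red n t := by
    rw [← hXs, map_multiset_sum, map_map]; rfl
  have h2 := two_mul_eq hn _ _ h1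
  have h3 : (T.map (dl n)).sum + ((T.map Prod.swap).map (dl n)).sum = 0 := by
    rw [map_map, ← Multiset.sum_map_add]
    apply Multiset.sum_eq_zero
    intro x hx
    obtain ⟨w, hw, rfl⟩ := mem_map.1 hx
    simp only [dl, Function.comp, Prod.fst_swap, Prod.snd_swap]
    linear_combination (two_n : (n : ZMod (2 * n)) + n = 0)
  refine ⟨T.map Prod.swap + U, ?_, by simp, ?_⟩
  · simp only [prs, Multiset.map_add, map_map, Function.comp_def, Prod.fst_swap, Prod.snd_swap]
    abel
  · rw [Multiset.map_add, sum_add, Multiset.map_add, sum_add, ← h2]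
    linear_combination h3

open Classical in
theorem quat_main (hn : 2 ≤ n) (S : Multiset (QuaternionGroup n)) (hS : IsMinimalProductOne S)
    (S₁ S₂ : Multiset (QuaternionGroup n)) (hSS : S = S₁ + S₂)
    (h2 : ∀ g ∈ S₂, ∃ i, g = QuaternionGroup.xa i) (hc : 2 * n + 4 ≤ card S₂) : False := by
  have hn0 : 0 < n := by omega
  have : NeZero n := ⟨by omega⟩
  obtain ⟨-, ⟨l, hl, hp⟩, hmin⟩ := hS
  obtain ⟨A, B, P, N, hd, h⟩ := list_decomp l
  rw [hl] at hd
  rw [hp] at h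
  rcases h with ⟨hPN, h0⟩ | ⟨-, h0⟩
  swap
  · rw [QuaternionGroup.one_def] at h0; cases h0
  have hm : n + 2 ≤ card N := by
    have hle : S₂ ≤ S := by rw [hSS]; exact le_add_left _ _
    have h3 : card (S.filter (fun g => ∃ i, g = QuaternionGroup.xa i)) = card P + card N := by
      rw [hd]
      simp [filter_add, filter_map, Function.comp_def]
    have h4 := card_le_card (filter_le_filter (fun g => ∃ i, g = QuaternionGroup.xa i) hle)
    rw [h3, filter_eq_self.2 h2] at h4
    omega
  obtain ⟨x, x', P, rfl, hx⟩ := exists_dup (red n) P (by rw [Nat.card_zmod]; omega)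
  obtain ⟨y, y', N, rfl, hy⟩ := exists_dup (red n) N (by rw [Nat.card_zmod]; omega)
  obtain ⟨W, rfl, rfl⟩ := exists_pairs P N (by simpa using hPN)
  simp only [card_cons, card_map] at hm
  have hWc : n ≤ card W := by omega
  have hW0 : W ≠ 0 := by rintro rfl; simp at hWc; omega
  have hsum : ∀ V : Multiset (ZMod (2 * n) × ZMod (2 * n)), (V.map (dl n)).sum =
      (V.map Prod.fst).sum - (V.map Prod.snd).sum + card V * n := by
    intro V
    induction V using Multiset.induction with
    | empty => simp
    | cons v V ih => simp only [map_cons, sum_cons, ih, dl, card_cons]; push_cast; ring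
  obtain ⟨F, hF⟩ : ∃ F, F = (x, y) ::ₘ (x', y') ::ₘ W := ⟨_, rfl⟩
  have hFs : (F.map (dl n)).sum + A.sum - B.sum = 0 := by
    rw [QuaternionGroup.one_def] at h0
    injection h0 with h0
    rw [h0, hsum, hF]
    simp
  have hSF : S = A.map QuaternionGroup.a + B.map QuaternionGroup.a + prs F := by
    rw [hd, hF]; simp [prs]
  have hWs : (W.map (dl n)).sum = - (x + x' - y - y') - A.sum + B.sum := by
    rw [hF] at hFs
    simp only [map_cons, sum_cons, dl] at hFs
    linear_combination hFs - (two_n : (n : ZMod (2 * n)) + n = 0)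
  have prs_ne : ∀ V : Multiset (ZMod (2 * n) × ZMod (2 * n)), V ≠ 0 → prs V ≠ 0 := by
    intro V hV h
    apply hV
    have := congrArg card h
    simp [prs] at this
    exact this
  have prs_ne' : ∀ V : Multiset (ZMod (2 * n) × ZMod (2 * n)), V ≠ 0 →
      A.map QuaternionGroup.a + B.map QuaternionGroup.a + prs V ≠ 0 := by
    intro V hV h
    exact prs_ne V hV (_root_.add_eq_zero.1 h).2
  -- Step I
  have stepI : ∀ T, T ≠ 0 → T ≤ F → card T < card F → (T.map (dl n)).sum ≠ 0 := by
    intro T hT hTF hTc hs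
    obtain ⟨U, rfl⟩ := Multiset.le_iff_exists_add.1 hTF
    have hU : U ≠ 0 := by rintro rfl; simp at hTc
    have p1 := prod_one_of 0 0 T hT (by simpa using hs)
    have p2 := prod_one_of A B U hU (by
      rw [Multiset.map_add, sum_add, hs] at hFs
      simpa using hFs)
    refine hmin _ _ ?_ (prs_ne' U hU) p1 p2 ?_
    · simpa using prs_ne T hT
    · rw [hSF, prs_add]; simp; abel
  -- Step I, second part
  have stepI' : ∀ T T' : Multiset (ZMod (2 * n) × ZMod (2 * n)), T ≠ 0 → T' ≠ 0 →
      T + T' ≤ F → card (T + T') < card F →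
      (T.map (fun w => red n (dl n w))).sum = 0 → (T'.map (fun w => red n (dl n w))).sum = 0 →
      False := by
    intro T T' hT hT' hle hlt h1 h2
    have e : ∀ V : Multiset (ZMod (2 * n) × ZMod (2 * n)),
        red n (V.map (dl n)).sum = (V.map (fun w => red n (dl n w))).sum := by
      intro V; rw [map_multiset_sum, map_map]; rfl
    rw [← e] at h1 h2
    have hlt' := hlt
    rw [card_add] at hlt'
    have a1 := (red_zero hn0 _ h1).resolve_left
      (stepI T hT ((le_add_right _ _).trans hle) (by omega))
    have a2 := (red_zero hn0 _ h2).resolve_left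
      (stepI T' hT' ((le_add_left _ _).trans hle) (by omega))
    refine stepI (T + T') (by simp [hT]) hle hlt ?_
    rw [Multiset.map_add, sum_add, a1, a2, two_n]
  -- Step II
  obtain ⟨K, hKp, hKc⟩ := subS_kneser (W.map (fun w => red n (dl n w)))
  by_cases hK : K = ⊤
  swap
  · obtain ⟨T, T', a1, a2, a3, a4, a5, a6⟩ := two_zero (fun w => red n (dl n w)) K hK F
      (W.filter (fun w => red n (dl n w) ∈ K))
      (by
        rw [hF]
        exact (filter_le _ _).trans ((le_cons_self _ _).trans (le_cons_self _ _)))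
      (fun v hv => (mem_filter.1 hv).2)
      (by rw [hF, Nat.card_zmod]; simpa using hWc)
      (by
        rw [filter_map, card_map] at hKc
        have := congrArg card (filter_add_not (fun w => red n (dl n w) ∈ K) W)
        rw [card_add] at this
        simp only [Function.comp_def] at hKc
        rw [Nat.card_zmod]
        omega)
    exact stepI' T T' a1 a2 a3 a4 a5 a6
  have hu : ∀ g, g ∈ SubS (W.map (fun w => red n (dl n w))) := by
    intro g
    have := hKp g (by simp [hK]) 0 ⟨0, Multiset.zero_le _, by simp⟩
    simpa using this
  -- Step III
  have fin : ∀ (T R : Multiset (ZMod (2 * n) × ZMod (2 * n))) (t : ZMod (2 * n)), T ≠ 0 →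
      prs F = prs T + prs R + prs W → (T.map (dl n)).sum = 0 →
      (R.map (dl n)).sum = x + x' - y - y' + (t + t) → False := by
    intro T R t hT hpr hTs hRs
    obtain ⟨W', hW', hWc', hWs'⟩ := flip_pairs hn0 W hu t
    have hRW : R + W' ≠ 0 := by
      intro h
      have := congrArg card h
      simp at this
      rw [this.2] at hWc'
      simp at hWc'
      exact hW0 (card_eq_zero.1 hWc'.symm)
    have p1 := prod_one_of 0 0 T hT (by simpa using hTs)
    have p2 := prod_one_of A B (R + W') hRW (by
      rw [Multiset.map_add, sum_add, hWs', hWs, hRs]; ring)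
    refine hmin _ _ ?_ (prs_ne' _ hRW) p1 p2 ?_
    · simpa using prs_ne T hT
    · rw [hSF, hpr, prs_add, hW']; simp; abel
  have hz := (two_n : (n : ZMod (2 * n)) + n = 0)
  rcases red_eq hn0 x' x hx.symm with h1 | h1
  · rcases red_eq hn0 y' y hy.symm with h2 | h2
    · refine fin {(x, x), (y, y)} 0 (y - x) (by simp) ?_ ?_ ?_
      · rw [hF]; simp only [prs, map_cons, insert_eq_cons, map_singleton, h1, h2]
        simp only [← singleton_add, Multiset.map_zero]; abel
      · simp [dl, hz]
      · simp only [Multiset.map_zero, sum_zero, h1, h2]; ring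
    · refine fin {(y, y')} {(x, x')} (y - x') (by simp) ?_ ?_ ?_
      · rw [hF]; simp only [prs, map_cons, map_singleton]; simp only [← singleton_add]; abel
      · simp [dl, h2]
      · simp [dl, h2]; linear_combination hz
  · refine fin {(x, x')} {(y, y')} (y - x) (by simp) ?_ ?_ ?_
    · rw [hF]; simp only [prs, map_cons, map_singleton]; simp only [← singleton_add]; abel
    · simp [dl, h1]
    · simp only [map_singleton, sum_singleton, dl, h1]; ring

end Quat

theorem exists_equiv (n : ℕ) (hn : 2 ≤ n)
    (G : Type*) [Group G] (α τ : G) (hcardG : Nat.card G = 4 * n)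
    (hgen : Subgroup.closure {α, τ} = ⊤) (hα : α ^ (2 * n) = 1) (hτ : τ ^ 2 = α ^ n)
    (hrel : τ * α = α⁻¹ * τ) :
    ∃ e : QuaternionGroup n ≃* G, ∀ i, e (QuaternionGroup.a i) ∈ Subgroup.zpowers α := by
  have : NeZero n := ⟨by omega⟩
  have : NeZero (2 * n) := ⟨by omega⟩
  let E : ZMod (2 * n) → G := fun i => α ^ i.val
  have hE : ∀ k : ℕ, E k = α ^ k := by
    intro k
    simp only [E, ZMod.val_natCast]
    rw [← pow_eq_pow_mod k hα]
  have hadd : ∀ i j, E (i + j) = E i * E j := by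
    intro i j
    have : i + j = ((i.val + j.val : ℕ) : ZMod (2 * n)) := by simp
    rw [this, hE, pow_add]
  have hE0 : E 0 = 1 := by simp [E]
  have hneg : ∀ i, E (-i) = (E i)⁻¹ := by
    intro i
    rw [eq_inv_iff_mul_eq_one, ← hadd]; simp [hE0]
  have hsub : ∀ i j, E (i - j) = (E j)⁻¹ * E i := by
    intro i j; rw [← hneg, ← hadd]; congr 1; ring
  have hcomm : ∀ i, E i * τ = τ * (E i)⁻¹ := by
    intro i
    have h1 : SemiconjBy τ α α⁻¹ := hrel
    have h2 : τ * E i = (E i)⁻¹ * τ := by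
      have := h1.pow_right i.val
      rw [inv_pow] at this
      exact this
    rw [eq_mul_inv_iff_mul_eq, mul_assoc, h2, mul_inv_cancel_left]
  let f : QuaternionGroup n → G := fun g => match g with
    | QuaternionGroup.a i => E i
    | QuaternionGroup.xa i => τ * E i
  have fa : ∀ i, f (QuaternionGroup.a i) = E i := fun _ => rfl
  have fx : ∀ i, f (QuaternionGroup.xa i) = τ * E i := fun _ => rfl
  have hmul : ∀ g h, f (g * h) = f g * f h := by
    rintro (i | i) (j | j)
    · rw [QuaternionGroup.a_mul_a, fa, fa, fa, hadd]
    · rw [QuaternionGroup.a_mul_xa, fa, fx, fx, hsub, ← mul_assoc, ← mul_assoc, hcomm]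
    · rw [QuaternionGroup.xa_mul_a, fa, fx, fx, hadd, mul_assoc]
    · rw [QuaternionGroup.xa_mul_xa, fa, fx, fx, mul_assoc, ← mul_assoc (E i), hcomm, mul_assoc,
        ← mul_assoc τ, ← pow_two, hτ, ← hE, add_sub_assoc, hadd, hsub]
  let φ : QuaternionGroup n →* G := MonoidHom.mk' f hmul
  have hsurj : Function.Surjective φ := by
    rw [← MonoidHom.range_eq_top, eq_top_iff, ← hgen, Subgroup.closure_le]
    rintro g (rfl | rfl)
    · refine ⟨QuaternionGroup.a ((1 : ℕ) : ZMod (2 * n)), ?_⟩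
      change E _ = _
      rw [hE, pow_one]
    · refine ⟨QuaternionGroup.xa 0, ?_⟩
      change _ * E _ = _
      rw [hE0, mul_one]
  have hbij : Function.Bijective φ := by
    have : Finite G := Nat.finite_of_card_ne_zero (by omega)
    rw [Nat.bijective_iff_surjective_and_card]
    refine ⟨hsurj, ?_⟩
    rw [hcardG, Nat.card_eq_fintype_card, QuaternionGroup.card]
  refine ⟨MulEquiv.ofBijective φ hbij, fun i => ?_⟩
  exact Subgroup.npow_mem_zpowers α i.val

theorem IsProductOne.map_equiv {G H : Type*} [Group G] [Group H] (e : G ≃* H) {S : Multiset G}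
    (h : IsProductOne S) : IsProductOne (S.map e) := by
  obtain ⟨l, rfl, hp⟩ := h
  exact ⟨l.map e, by simp, by rw [← map_list_prod, hp, _root_.map_one]⟩

theorem IsMinimalProductOne.map_equiv {G H : Type*} [Group G] [Group H] (e : G ≃* H)
    {S : Multiset G} (h : IsMinimalProductOne S) : IsMinimalProductOne (S.map e) := by
  obtain ⟨h0, h1, h2⟩ := h
  refine ⟨by simpa using h0, h1.map_equiv e, ?_⟩
  intro T₁ T₂ n1 n2 p1 p2 heq
  refine h2 (T₁.map e.symm) (T₂.map e.symm) (by simpa using n1) (by simpa using n2)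
    (p1.map_equiv _) (p2.map_equiv _) ?_
  rw [← Multiset.map_add, ← heq, map_map]
  simp

theorem no_minimal_product_one_with_long_reflection_part_dicyclic
    (n : ℕ) (hn : 2 ≤ n)
    (G : Type*) [Group G] (α τ : G) (hcardG : Nat.card G = 4 * n)
    (hgen : Subgroup.closure {α, τ} = ⊤) (hα : α ^ (2 * n) = 1) (hτ : τ ^ 2 = α ^ n)
    (hrel : τ * α = α⁻¹ * τ) :
    ¬ ∃ S₁ S₂ : Multiset G,
        IsMinimalProductOne (S₁ + S₂) ∧
        (∀ g ∈ S₁, g ∈ Subgroup.zpowers α) ∧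
        (∀ g ∈ S₂, g ∉ Subgroup.zpowers α) ∧
        2 * n + 4 ≤ Multiset.card S₂ := by
  rintro ⟨S₁, S₂, hmin, -, h2, hc⟩
  obtain ⟨e, he⟩ := exists_equiv n hn G α τ hcardG hgen hα hτ hrel
  refine quat_main hn _ (hmin.map_equiv e.symm) (S₁.map e.symm) (S₂.map e.symm)
    (Multiset.map_add _ _ _) ?_ (by simpa using hc)
  intro g hg
  obtain ⟨s, hs, rfl⟩ := Multiset.mem_map.1 hg
  rcases hes : e.symm s with i | i
  · exfalso
    apply h2 s hs
    have := he i
    rw [← hes] at this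
    simpa using this
  · exact ⟨i, rfl⟩
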